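/- Suppose σ = 0 and fix α > 0. Define f(T) = ∫_{(0,∞)^p} (1 − e^{−α ψ(2Tw₁,…,2Tw_p)}) ρ(dw). Then f(T) = Θ(log T) as T → ∞: there exist constants 0 < c₁ ≤ c₂ < ∞ and T₀ > 1 such that c₁ log T ≤ f(T) ≤ c₂ log T for all T ≥ T₀. Consequently the expected number of nodes E[V_{α,T}] = α f(T) satisfies E[V_{α,T}] = Θ(log T) as T → ∞. -/

import Mathlib

open MeasureTheory Real Filter

/-- The Lévy measure of a generalized gamma process: the measure on `(0,∞)` with density
`w ↦ w^(-1-σ) * exp(-τ*w) / Γ(1-σ)` with respect to Lebesgue measure. -/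
noncomputable def rho0 (σ τ : ℝ) : Measure ℝ :=
  ((volume : Measure ℝ).restrict (Set.Ioi 0)).withDensity
    (fun w => ENNReal.ofReal (w ^ (-1 - σ) * Real.exp (-τ * w) / Real.Gamma (1 - σ)))

/-- The Gamma(a,b) probability measure on `(0,∞)`, with density
`x ↦ b^a x^(a−1) e^(−b x) / Γ(a)` with respect to Lebesgue measure. -/
noncomputable def gammaM (a b : ℝ) : Measure ℝ :=
  ((volume : Measure ℝ).restrict (Set.Ioi 0)).withDensity
    (fun x => ENNReal.ofReal (b ^ a * x ^ (a - 1) * Real.exp (-b * x) / Real.Gamma a))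

/-- The multivariate Lévy measure `ρ` of the compound CRM with independent gamma scores:
the pushforward of `ρ₀ ⊗ Gamma(a₁,b₁) ⊗ ⋯ ⊗ Gamma(a_p,b_p)` under
`(w₀, β₁, …, β_p) ↦ (w₀β₁, …, w₀β_p)`. -/
noncomputable def rhoC (σ τ : ℝ) (p : ℕ) (a b : Fin p → ℝ) : Measure (Fin p → ℝ) :=
  Measure.map (fun x : ℝ × (Fin p → ℝ) => fun k => x.1 * x.2 k)
    ((rho0 σ τ).prod (Measure.pi fun k => gammaM (a k) (b k)))

/-- The Laplace exponent `ψ(t) = ∫ (1 − e^{−Σ_k t_k v_k}) ρ(dv)` of the compound CRM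
(a finite quantity, expressed here as a Bochner integral). -/
noncomputable def psi (σ τ : ℝ) (p : ℕ) (a b : Fin p → ℝ) (t : Fin p → ℝ) : ℝ :=
  ∫ v, (1 - Real.exp (-∑ k, t k * v k)) ∂(rhoC σ τ p a b)

/-- `∫ (1 − e^{−α ψ(2Tw₁,…,2Tw_p)}) ρ(dw)`, so that `E[V_{α,T}]` equals `α` times this. -/
noncomputable def nodesIntegral (σ τ : ℝ) (p : ℕ) (a b : Fin p → ℝ) (α T : ℝ) : ℝ :=
  ∫ w, (1 - Real.exp (-α * psi σ τ p a b (fun k => 2 * T * w k))) ∂(rhoC σ τ p a b)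

section Rho0

variable {τ : ℝ}

lemma rho0_zero_eq (τ : ℝ) :
    rho0 0 τ = ((volume : Measure ℝ).restrict (Set.Ioi 0)).withDensity
      (fun w => ENNReal.ofReal (w⁻¹ * Real.exp (-τ * w))) := by
  simp [rho0, Real.rpow_neg_one]

instance (σ τ : ℝ) : SFinite (rho0 σ τ) := by
  unfold rho0; infer_instance

lemma ae_rho0_pos (σ τ : ℝ) : ∀ᵐ w ∂(rho0 σ τ), 0 < w :=
  (withDensity_absolutelyContinuous _ _).ae_le (ae_restrict_mem measurableSet_Ioi)

lemma integrable_rho0_zero_iff (τ : ℝ) (g : ℝ → ℝ) :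
    Integrable g (rho0 0 τ) ↔
      IntegrableOn (fun w => w⁻¹ * Real.exp (-τ * w) * g w) (Set.Ioi 0) := by
  rw [rho0_zero_eq, integrable_withDensity_iff_integrable_smul' (by fun_prop) (by simp)]
  refine integrable_congr ?_
  filter_upwards [ae_restrict_mem measurableSet_Ioi] with w (hw : 0 < w)
  rw [ENNReal.toReal_ofReal (by positivity), smul_eq_mul]

lemma integral_rho0_zero (τ : ℝ) (g : ℝ → ℝ) :
    ∫ w, g w ∂(rho0 0 τ) = ∫ w in Set.Ioi 0, w⁻¹ * Real.exp (-τ * w) * g w := by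
  rw [rho0_zero_eq, integral_withDensity_eq_integral_toReal_smul (by fun_prop) (by simp)]
  refine integral_congr_ae ?_
  filter_upwards [ae_restrict_mem measurableSet_Ioi] with w (hw : 0 < w)
  rw [ENNReal.toReal_ofReal (by positivity), smul_eq_mul]

lemma integrable_id_rho0_zero (hτ : 0 < τ) : Integrable (fun w : ℝ => w) (rho0 0 τ) := by
  rw [integrable_rho0_zero_iff]
  refine (integrableOn_exp_mul_Ioi (neg_neg_of_pos hτ) 0).congr_fun (fun w (hw : 0 < w) => ?_)
    measurableSet_Ioi
  have := hw.ne'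
  field_simp

lemma integrable_indicator_Iic_rho0_zero (hτ : 0 < τ) (s : ℝ) :
    Integrable ((Set.Iic s).indicator fun w : ℝ => w) (rho0 0 τ) :=
  (integrable_id_rho0_zero hτ).indicator measurableSet_Iic

lemma integral_indicator_Iic_rho0_zero_le (hτ : 0 < τ) {s : ℝ} (hs : 0 < s) :
    ∫ w, (Set.Iic s).indicator (fun w : ℝ => w) w ∂(rho0 0 τ) ≤ s := by
  have hint := (integrable_rho0_zero_iff τ _).1 (integrable_indicator_Iic_rho0_zero hτ s)
  rw [integral_rho0_zero]
  have hone : IntegrableOn (fun _ : ℝ => (1 : ℝ)) (Set.Ioc 0 s) := by simp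
  calc _ ≤ ∫ w in Set.Ioi 0, (Set.Ioc 0 s).indicator (fun _ => (1 : ℝ)) w := by
        refine setIntegral_mono_on hint
          (hone.integrable_indicator measurableSet_Ioc).integrableOn measurableSet_Ioi
          fun w (hw : 0 < w) => ?_
        by_cases h : w ≤ s
        · rw [Set.indicator_of_mem (show w ∈ Set.Iic s from h),
            Set.indicator_of_mem (show w ∈ Set.Ioc 0 s from ⟨hw, h⟩),
            mul_right_comm, inv_mul_cancel₀ hw.ne', one_mul]
          exact Real.exp_le_one_iff.2 (by nlinarith)
        · simp [h]
    _ = s := by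
        rw [setIntegral_indicator measurableSet_Ioc,
          Set.inter_eq_right.2 Set.Ioc_subset_Ioi_self]
        simp [hs.le]

lemma integrableOn_inv_Ioc {s : ℝ} (hs : 0 < s) :
    IntegrableOn (fun w : ℝ => w⁻¹) (Set.Ioc s 1) := by
  refine (ContinuousOn.integrableOn_Icc (continuousOn_inv₀.mono ?_)).mono_set
    Set.Ioc_subset_Icc_self
  intro w hw
  exact (hs.trans_le hw.1).ne'

lemma setIntegral_inv_Ioc {s : ℝ} (hs : 0 < s) (hs1 : s ≤ 1) :
    ∫ w in Set.Ioc s 1, w⁻¹ = -Real.log s := by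
  rw [← intervalIntegral.integral_of_le hs1, integral_inv_of_pos hs one_pos]
  simp

lemma integrable_indicator_Ioi_rho0_zero (hτ : 0 < τ) {s : ℝ} (hs : 0 < s) :
    Integrable ((Set.Ioi s).indicator fun _ => (1 : ℝ)) (rho0 0 τ) := by
  refine ((integrable_id_rho0_zero hτ).const_mul s⁻¹).mono'
    (by fun_prop (disch := exact measurableSet_Ioi)) ?_
  filter_upwards [ae_rho0_pos 0 τ] with w hw
  by_cases h : s < w
  · rw [Set.indicator_of_mem (show w ∈ Set.Ioi s from h), norm_one, ← div_eq_inv_mul, one_le_div hs]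
    exact h.le
  · simp [h]; positivity

lemma integral_indicator_Ioi_rho0_zero_le (hτ : 0 < τ) {s : ℝ} (hs : 0 < s) (hs1 : s ≤ 1) :
    ∫ w, (Set.Ioi s).indicator (fun _ => (1 : ℝ)) w ∂(rho0 0 τ) ≤ -Real.log s + τ⁻¹ := by
  have hint := (integrable_rho0_zero_iff τ _).1 (integrable_indicator_Ioi_rho0_zero hτ hs)
  have hexp := integrableOn_exp_mul_Ioi (neg_neg_of_pos hτ) 0
  have hinv := ((integrableOn_inv_Ioc hs).integrable_indicator measurableSet_Ioc).integrableOn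
    (s := Set.Ioi 0)
  rw [integral_rho0_zero]
  calc _ ≤ ∫ w in Set.Ioi 0,
          ((Set.Ioc s 1).indicator (fun w : ℝ => w⁻¹) w + Real.exp (-τ * w)) := by
        refine setIntegral_mono_on hint (hinv.add hexp) measurableSet_Ioi
          fun w (hw : 0 < w) => ?_
        by_cases h : s < w
        · rw [Set.indicator_of_mem (show w ∈ Set.Ioi s from h), mul_one]
          by_cases h1 : w ≤ 1
          · rw [Set.indicator_of_mem (show w ∈ Set.Ioc s 1 from ⟨h, h1⟩)]
            have : Real.exp (-τ * w) ≤ 1 := Real.exp_le_one_iff.2 (by nlinarith)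
            have := mul_le_mul_of_nonneg_left this (inv_pos.2 hw).le
            have := Real.exp_pos (-τ * w)
            linarith
          · rw [Set.indicator_of_notMem (fun h' => h1 h'.2), zero_add]
            exact mul_le_of_le_one_left (Real.exp_pos _).le (inv_le_one_of_one_le₀ (not_le.1 h1).le)
        · have h' : w ∉ Set.Ioc s 1 := fun h' => h h'.1
          simp [h, h', (Real.exp_pos _).le]
    _ = -Real.log s + τ⁻¹ := by
        rw [integral_add hinv hexp, setIntegral_indicator measurableSet_Ioc,
          Set.inter_eq_right.2 (show Set.Ioc s 1 ⊆ Set.Ioi 0 from fun w hw => hs.trans hw.1),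
           setIntegral_inv_Ioc hs hs1,
          integral_exp_mul_Ioi (neg_neg_of_pos hτ)]
        simp

lemma le_integral_indicator_Ioc_rho0_zero (hτ : 0 < τ) {s : ℝ} (hs : 0 < s) (hs1 : s ≤ 1) :
    Real.exp (-τ) * -Real.log s ≤
      ∫ w, (Set.Ioc s 1).indicator (fun _ => (1 : ℝ)) w ∂(rho0 0 τ) := by
  have hinv := ((integrableOn_inv_Ioc hs).integrable_indicator measurableSet_Ioc).integrableOn
    (s := Set.Ioi 0)
  have hint := (integrable_rho0_zero_iff τ _).1
    ((integrable_indicator_Ioi_rho0_zero hτ hs).indicator (measurableSet_Iic (a := (1 : ℝ))))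
  rw [Set.indicator_indicator, Set.inter_comm, Set.Ioi_inter_Iic] at hint
  rw [integral_rho0_zero]
  calc _ = ∫ w in Set.Ioi 0, Real.exp (-τ) * (Set.Ioc s 1).indicator (fun w : ℝ => w⁻¹) w := by
        rw [integral_const_mul, setIntegral_indicator measurableSet_Ioc,
          Set.inter_eq_right.2 (show Set.Ioc s 1 ⊆ Set.Ioi 0 from fun w hw => hs.trans hw.1),
           setIntegral_inv_Ioc hs hs1]
    _ ≤ _ := by
        refine setIntegral_mono_on (hinv.const_mul _) hint measurableSet_Ioi
          fun w (hw : 0 < w) => ?_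
        by_cases h : w ∈ Set.Ioc s 1
        · simp only [Set.indicator_of_mem h, mul_one]
          rw [mul_comm]
          have : Real.exp (-τ) ≤ Real.exp (-τ * w) := Real.exp_le_exp.2 (by nlinarith [h.2])
          exact mul_le_mul_of_nonneg_left this (inv_pos.2 hw).le
        · simp [h]

end Rho0

section GammaM

variable {a b : ℝ}

lemma gammaM_eq_gammaMeasure (a b : ℝ) : gammaM a b = ProbabilityTheory.gammaMeasure a b := by
  rw [gammaM, ← withDensity_indicator measurableSet_Ioi, ProbabilityTheory.gammaMeasure]
  refine withDensity_congr_ae ?_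
  filter_upwards [compl_mem_ae_iff.2 (measure_singleton (0 : ℝ))] with x hx
  rcases lt_or_gt_of_ne (show x ≠ 0 from hx) with h | h
  · rw [ProbabilityTheory.gammaPDF_of_neg h, Set.indicator_of_notMem (by simp [h.le])]
  · rw [ProbabilityTheory.gammaPDF_of_nonneg h.le, Set.indicator_of_mem (show x ∈ Set.Ioi 0 from h)]
    congr 1
    rw [neg_mul]
    ring

instance (a b : ℝ) : SigmaFinite (gammaM a b) :=
  SigmaFinite.withDensity_ofReal _

lemma isProbabilityMeasure_gammaM (ha : 0 < a) (hb : 0 < b) : IsProbabilityMeasure (gammaM a b) :=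
  gammaM_eq_gammaMeasure a b ▸ ProbabilityTheory.isProbabilityMeasure_gammaMeasure ha hb

lemma ae_gammaM_pos (a b : ℝ) : ∀ᵐ x ∂(gammaM a b), 0 < x :=
  (withDensity_absolutelyContinuous _ _).ae_le (ae_restrict_mem measurableSet_Ioi)

lemma integrable_id_gammaM (ha : 0 < a) (hb : 0 < b) :
    Integrable (fun x : ℝ => x) (gammaM a b) := by
  rw [gammaM, integrable_withDensity_iff_integrable_smul' (by fun_prop) (by simp)]
  have h := (integrableOn_rpow_mul_exp_neg_mul_rpow (s := a) (by linarith) one_pos hb).const_mul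
    (b ^ a / Real.Gamma a)
  refine h.congr ?_
  filter_upwards [ae_restrict_mem measurableSet_Ioi] with x (hx : 0 < x)
  have := Real.Gamma_pos_of_pos ha
  rw [ENNReal.toReal_ofReal (by positivity), smul_eq_mul, Real.rpow_sub_one hx.ne', Real.rpow_one]
  field_simp

lemma gammaM_Icc_pos (ha : 0 < a) (hb : 0 < b) : 0 < gammaM a b (Set.Icc 1 2) := by
  rw [pos_iff_ne_zero, gammaM, Ne, withDensity_apply_eq_zero' (by fun_prop)]
  refine ne_of_gt (lt_of_lt_of_le ?_ (measure_mono (s := Set.Icc 1 2) fun x hx => ⟨?_, hx⟩))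
  · rw [Measure.restrict_apply measurableSet_Icc,
      Set.inter_eq_left.2 (show Set.Icc (1 : ℝ) 2 ⊆ Set.Ioi 0 from
        fun x hx => one_pos.trans_le hx.1)]
    simp
  · have hx0 : 0 < x := one_pos.trans_le hx.1
    have := Real.Gamma_pos_of_pos ha
    simp only [Set.mem_ofPred_eq, ne_eq, ENNReal.ofReal_eq_zero, not_le]
    positivity

end GammaM

section RhoC

variable {τ : ℝ} {p : ℕ} {a b : Fin p → ℝ}

lemma one_sub_exp_neg_le (x : ℝ) : 1 - Real.exp (-x) ≤ x := by
  linarith [Real.add_one_le_exp (-x)]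

lemma one_sub_exp_neg_nonneg {x : ℝ} (hx : 0 ≤ x) : 0 ≤ 1 - Real.exp (-x) :=
  sub_nonneg.2 (Real.exp_le_one_iff.2 (neg_nonpos.2 hx))

lemma one_sub_exp_neg_mono {x y : ℝ} (h : x ≤ y) : 1 - Real.exp (-x) ≤ 1 - Real.exp (-y) :=
  sub_le_sub_left (Real.exp_le_exp.2 (neg_le_neg h)) 1

lemma measurable_scale (p : ℕ) :
    Measurable fun x : ℝ × (Fin p → ℝ) => fun k => x.1 * x.2 k := by
  fun_prop

instance (σ τ : ℝ) (p : ℕ) (a b : Fin p → ℝ) : SFinite (rhoC σ τ p a b) := by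
  unfold rhoC; infer_instance

lemma ae_pi_gammaM_pos (a b : Fin p → ℝ) :
    ∀ᵐ β ∂(Measure.pi fun k => gammaM (a k) (b k)), ∀ k, 0 < β k := by
  exact eventually_all.2 fun k =>
    Measure.tendsto_eval_ae_ae.eventually (ae_gammaM_pos (a k) (b k))

lemma ae_prod_pos (τ : ℝ) (a b : Fin p → ℝ) :
    ∀ᵐ x ∂((rho0 0 τ).prod (Measure.pi fun k => gammaM (a k) (b k))),
      0 < x.1 ∧ ∀ k, 0 < x.2 k := by
  exact (Measure.quasiMeasurePreserving_fst.ae (ae_rho0_pos 0 τ)).and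
    (Measure.quasiMeasurePreserving_snd.ae (ae_pi_gammaM_pos a b))

lemma ae_rhoC_pos (τ : ℝ) (a b : Fin p → ℝ) :
    ∀ᵐ v ∂(rhoC 0 τ p a b), ∀ k, 0 < v k := by
  have hm : MeasurableSet {v : Fin p → ℝ | ∀ k, 0 < v k} := by measurability
  rw [rhoC, ae_map_iff (measurable_scale p).aemeasurable hm]
  filter_upwards [ae_prod_pos τ a b] with x hx k
  exact mul_pos hx.1 (hx.2 k)

lemma integrable_eval_pi_gammaM (ha : ∀ k, 0 < a k) (hb : ∀ k, 0 < b k) (k : Fin p) :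
    Integrable (fun β : Fin p → ℝ => β k) (Measure.pi fun k => gammaM (a k) (b k)) := by
  have := fun k => isProbabilityMeasure_gammaM (ha k) (hb k)
  exact (measurePreserving_eval (fun k => gammaM (a k) (b k)) k).integrable_comp_of_integrable
    (integrable_id_gammaM (ha k) (hb k))

lemma integrable_eval_rhoC (hτ : 0 < τ) (ha : ∀ k, 0 < a k) (hb : ∀ k, 0 < b k) (k : Fin p) :
    Integrable (fun v : Fin p → ℝ => v k) (rhoC 0 τ p a b) := by
  rw [rhoC, integrable_map_measure (measurable_pi_apply k).aestronglyMeasurable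
    (measurable_scale p).aemeasurable]
  exact (integrable_id_rho0_zero hτ).mul_prod (integrable_eval_pi_gammaM ha hb k)

lemma integrable_one_sub_exp_rhoC (hτ : 0 < τ) (ha : ∀ k, 0 < a k) (hb : ∀ k, 0 < b k)
    {t : Fin p → ℝ} (ht : ∀ k, 0 ≤ t k) :
    Integrable (fun v => 1 - Real.exp (-∑ k, t k * v k)) (rhoC 0 τ p a b) := by
  refine (integrable_finsetSum Finset.univ
    fun k _ => (integrable_eval_rhoC hτ ha hb k).const_mul (t k)).mono'
    (Measurable.aestronglyMeasurable (by fun_prop)) ?_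
  filter_upwards [ae_rhoC_pos τ a b] with v hv
  rw [Real.norm_of_nonneg (one_sub_exp_neg_nonneg
    (Finset.sum_nonneg fun k _ => mul_nonneg (ht k) (hv k).le))]
  exact one_sub_exp_neg_le _

lemma psi_nonneg {t : Fin p → ℝ} (ht : ∀ k, 0 ≤ t k) :
    0 ≤ psi 0 τ p a b t := by
  refine integral_nonneg_of_ae ?_
  filter_upwards [ae_rhoC_pos τ a b] with v hv
  exact one_sub_exp_neg_nonneg (Finset.sum_nonneg fun k _ => mul_nonneg (ht k) (hv k).le)

lemma psi_le_sum (hτ : 0 < τ) (ha : ∀ k, 0 < a k) (hb : ∀ k, 0 < b k) {t : Fin p → ℝ}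
    (ht : ∀ k, 0 ≤ t k) :
    psi 0 τ p a b t ≤ ∑ k, t k * ∫ v, v k ∂(rhoC 0 τ p a b) := by
  have hi := fun k => (integrable_eval_rhoC hτ ha hb k).const_mul (t k)
  simp_rw [← integral_const_mul]
  rw [← integral_finsetSum _ fun k _ => hi k]
  exact integral_mono (integrable_one_sub_exp_rhoC hτ ha hb ht)
    (integrable_finsetSum _ fun k _ => hi k) fun v => one_sub_exp_neg_le _

lemma psi_mono (hτ : 0 < τ) (ha : ∀ k, 0 < a k) (hb : ∀ k, 0 < b k) {s t : Fin p → ℝ}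
    (hs : ∀ k, 0 ≤ s k) (hst : ∀ k, s k ≤ t k) : psi 0 τ p a b s ≤ psi 0 τ p a b t := by
  refine integral_mono_ae (integrable_one_sub_exp_rhoC hτ ha hb hs)
    (integrable_one_sub_exp_rhoC hτ ha hb fun k => (hs k).trans (hst k)) ?_
  filter_upwards [ae_rhoC_pos τ a b] with v hv
  exact one_sub_exp_neg_mono
    (Finset.sum_le_sum fun k _ => mul_le_mul_of_nonneg_right (hst k) (hv k).le)

lemma rhoC_zero_ne_zero (hτ : 0 < τ) (ha : ∀ k, 0 < a k) (hb : ∀ k, 0 < b k) :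
    rhoC 0 τ p a b ≠ 0 := by
  have := fun k => isProbabilityMeasure_gammaM (ha k) (hb k)
  intro h
  rw [rhoC, Measure.map_eq_zero_iff (measurable_scale p).aemeasurable,
    ← Measure.measure_univ_eq_zero, ← Set.univ_prod_univ, Measure.prod_prod, mul_eq_zero,
    Measure.measure_univ_eq_zero, Measure.measure_univ_eq_zero] at h
  rcases h with h | h
  · have hlt := le_integral_indicator_Ioc_rho0_zero hτ (Real.exp_pos (-1)) (by simp)
    rw [h, integral_zero_measure, Real.log_exp, neg_neg, mul_one] at hlt
    exact hlt.not_gt (Real.exp_pos _)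
  · exact IsProbabilityMeasure.ne_zero _ h

lemma psi_one_pos (hτ : 0 < τ) (hp : 1 ≤ p) (ha : ∀ k, 0 < a k) (hb : ∀ k, 0 < b k) :
    0 < psi 0 τ p a b fun _ => 1 := by
  have hpos : ∀ᵐ v ∂(rhoC 0 τ p a b), 0 < 1 - Real.exp (-∑ k, 1 * v k) := by
    filter_upwards [ae_rhoC_pos τ a b] with v hv
    have : 0 < ∑ k, 1 * v k :=
      Finset.sum_pos (fun k _ => by simpa using hv k) ⟨⟨0, hp⟩, Finset.mem_univ _⟩
    simpa using this
  refine (integral_nonneg_of_ae (hpos.mono fun v hv => hv.le)).lt_of_ne fun h => ?_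
  rw [eq_comm, integral_eq_zero_iff_of_nonneg_ae (hpos.mono fun v hv => hv.le)
    (integrable_one_sub_exp_rhoC hτ ha hb fun _ => zero_le_one)] at h
  have hF : ∀ᵐ v ∂(rhoC 0 τ p a b), False := by
    filter_upwards [hpos, h] with v h1 h2
    exact h1.ne' h2
  exact rhoC_zero_ne_zero hτ ha hb (ae_eq_bot.1 (eventually_false_iff_eq_bot.1 hF))

lemma measurable_psi (σ τ : ℝ) (p : ℕ) (a b : Fin p → ℝ) : Measurable (psi σ τ p a b) := by
  unfold psi
  refine StronglyMeasurable.measurable (StronglyMeasurable.integral_prod_right ?_)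
  exact Measurable.stronglyMeasurable (by unfold Function.uncurry; fun_prop)

lemma nodesIntegral_eq_prod (σ τ : ℝ) (p : ℕ) (a b : Fin p → ℝ) (α T : ℝ) :
    nodesIntegral σ τ p a b α T =
      ∫ x, (1 - Real.exp (-(α * psi σ τ p a b (fun k => 2 * T * (x.1 * x.2 k)))))
        ∂((rho0 σ τ).prod (Measure.pi fun k => gammaM (a k) (b k))) := by
  have := measurable_psi σ τ p a b
  rw [nodesIntegral, rhoC, integral_map (measurable_scale p).aemeasurable
    (Measurable.aestronglyMeasurable (by fun_prop))]
  simp_rw [neg_mul]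

end RhoC

section Bounds

variable {τ : ℝ} {p : ℕ} {a b : Fin p → ℝ} {α T : ℝ}

/-- A product-form envelope for the integrand of `nodesIntegral`: `1` when `w₀ > 1/T`, and the
linear bound on the Laplace exponent when `w₀ ≤ 1/T`. -/
noncomputable def nodesEnvelope (τ : ℝ) (p : ℕ) (a b : Fin p → ℝ) (α T : ℝ)
    (x : ℝ × (Fin p → ℝ)) : ℝ :=
  (Set.Ioi T⁻¹).indicator (fun _ => (1 : ℝ)) x.1 * 1 +
    (Set.Iic T⁻¹).indicator (fun w : ℝ => w) x.1 *
      (2 * α * T * ∑ k, x.2 k * ∫ v, v k ∂(rhoC 0 τ p a b))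

lemma nodesIntegrand_nonneg (hα : 0 < α) (hT : 0 < T)
    {x : ℝ × (Fin p → ℝ)} (hx : 0 < x.1 ∧ ∀ k, 0 < x.2 k) :
    0 ≤ 1 - Real.exp (-(α * psi 0 τ p a b (fun k => 2 * T * (x.1 * x.2 k)))) := by
  refine one_sub_exp_neg_nonneg (mul_nonneg hα.le (psi_nonneg fun k => ?_))
  have := mul_pos hx.1 (hx.2 k)
  positivity

lemma nodesIntegrand_le_envelope (hτ : 0 < τ) (ha : ∀ k, 0 < a k) (hb : ∀ k, 0 < b k)
    (hα : 0 < α) (hT : 0 < T) {x : ℝ × (Fin p → ℝ)} (hx : 0 < x.1 ∧ ∀ k, 0 < x.2 k) :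
    1 - Real.exp (-(α * psi 0 τ p a b (fun k => 2 * T * (x.1 * x.2 k)))) ≤
      nodesEnvelope τ p a b α T x := by
  rw [nodesEnvelope]
  by_cases h : x.1 ≤ T⁻¹
  · rw [Set.indicator_of_notMem (show x.1 ∉ Set.Ioi T⁻¹ from not_lt.2 h),
      Set.indicator_of_mem (show x.1 ∈ Set.Iic T⁻¹ from h), zero_mul, zero_add]
    have hnn : ∀ k, 0 ≤ 2 * T * (x.1 * x.2 k) := fun k => by
      have := mul_pos hx.1 (hx.2 k)
      positivity
    refine (one_sub_exp_neg_le _).trans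
      ((mul_le_mul_of_nonneg_left (psi_le_sum hτ ha hb hnn) hα.le).trans_eq ?_)
    simp only [Finset.mul_sum]
    exact Finset.sum_congr rfl fun k _ => by ring
  · rw [Set.indicator_of_mem (show x.1 ∈ Set.Ioi T⁻¹ from not_le.1 h),
      Set.indicator_of_notMem (show x.1 ∉ Set.Iic T⁻¹ from h), zero_mul, add_zero, one_mul]
    exact sub_le_self _ (Real.exp_pos _).le

lemma integrable_sum_score (ha : ∀ k, 0 < a k) (hb : ∀ k, 0 < b k) (c : Fin p → ℝ) :
    Integrable (fun β : Fin p → ℝ => ∑ k, β k * c k)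
      (Measure.pi fun k => gammaM (a k) (b k)) :=
  integrable_finsetSum _ fun k _ => (integrable_eval_pi_gammaM ha hb k).mul_const _

lemma integrable_nodesEnvelope (hτ : 0 < τ) (ha : ∀ k, 0 < a k) (hb : ∀ k, 0 < b k)
    (hT : 0 < T) :
    Integrable (nodesEnvelope τ p a b α T)
      ((rho0 0 τ).prod (Measure.pi fun k => gammaM (a k) (b k))) := by
  have := fun k => isProbabilityMeasure_gammaM (ha k) (hb k)
  exact ((integrable_indicator_Ioi_rho0_zero hτ (inv_pos.2 hT)).mul_prod
      (integrable_const (1 : ℝ))).add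
    ((integrable_indicator_Iic_rho0_zero hτ T⁻¹).mul_prod
      ((integrable_sum_score ha hb _).const_mul _))

lemma integrable_nodesIntegrand (hτ : 0 < τ) (ha : ∀ k, 0 < a k) (hb : ∀ k, 0 < b k)
    (hα : 0 < α) (hT : 0 < T) :
    Integrable (fun x : ℝ × (Fin p → ℝ) =>
        1 - Real.exp (-(α * psi 0 τ p a b (fun k => 2 * T * (x.1 * x.2 k)))))
      ((rho0 0 τ).prod (Measure.pi fun k => gammaM (a k) (b k))) := by
  have := measurable_psi 0 τ p a b
  refine (integrable_nodesEnvelope (α := α) hτ ha hb hT).mono'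
    (Measurable.aestronglyMeasurable (by fun_prop)) ?_
  filter_upwards [ae_prod_pos τ a b] with x hx
  rw [Real.norm_of_nonneg (nodesIntegrand_nonneg hα hT hx)]
  exact nodesIntegrand_le_envelope hτ ha hb hα hT hx

lemma nodesIntegral_le (hτ : 0 < τ) (ha : ∀ k, 0 < a k) (hb : ∀ k, 0 < b k) (hα : 0 < α) :
    ∃ K : ℝ, 0 ≤ K ∧ ∀ T, 1 ≤ T → nodesIntegral 0 τ p a b α T ≤ Real.log T + K := by
  have := fun k => isProbabilityMeasure_gammaM (ha k) (hb k)
  set M : ℝ := ∫ β, ∑ k, β k * ∫ v, v k ∂(rhoC 0 τ p a b)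
    ∂(Measure.pi fun k => gammaM (a k) (b k)) with hM
  have hM0 : 0 ≤ M := by
    refine integral_nonneg_of_ae ?_
    filter_upwards [ae_pi_gammaM_pos a b] with β hβ
    refine Finset.sum_nonneg fun k _ => mul_nonneg (hβ k).le (integral_nonneg_of_ae ?_)
    filter_upwards [ae_rhoC_pos τ a b] with v hv
    exact (hv k).le
  refine ⟨τ⁻¹ + 2 * α * M, by positivity, fun T hT1 => ?_⟩
  have hT : 0 < T := one_pos.trans_le hT1
  have hlog := integral_indicator_Ioi_rho0_zero_le hτ (inv_pos.2 hT) (inv_le_one_of_one_le₀ hT1)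
  have hlin := mul_le_mul_of_nonneg_right
    (integral_indicator_Iic_rho0_zero_le hτ (inv_pos.2 hT))
    (show 0 ≤ 2 * α * T * M by positivity)
  rw [Real.log_inv, neg_neg] at hlog
  have hcancel : T⁻¹ * (2 * α * T * M) = 2 * α * M := by field_simp
  rw [nodesIntegral_eq_prod]
  calc _ ≤ ∫ x, nodesEnvelope τ p a b α T x
          ∂((rho0 0 τ).prod (Measure.pi fun k => gammaM (a k) (b k))) := by
        refine integral_mono_ae (integrable_nodesIntegrand hτ ha hb hα hT)
          (integrable_nodesEnvelope hτ ha hb hT) ?_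
        filter_upwards [ae_prod_pos τ a b] with x hx
        exact nodesIntegrand_le_envelope hτ ha hb hα hT hx
    _ = (∫ w, (Set.Ioi T⁻¹).indicator (fun _ => (1 : ℝ)) w ∂(rho0 0 τ)) +
          (∫ w, (Set.Iic T⁻¹).indicator (fun w : ℝ => w) w ∂(rho0 0 τ)) *
            (2 * α * T * M) := by
        unfold nodesEnvelope
        rw [integral_add ((integrable_indicator_Ioi_rho0_zero hτ (inv_pos.2 hT)).mul_prod
            (integrable_const (1 : ℝ)))
          ((integrable_indicator_Iic_rho0_zero hτ T⁻¹).mul_prod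
            ((integrable_sum_score ha hb _).const_mul _)),
          integral_prod_mul _ fun _ : Fin p → ℝ => (1 : ℝ),
          integral_prod_mul ((Set.Iic T⁻¹).indicator fun w : ℝ => w)
            fun β : Fin p → ℝ => 2 * α * T * ∑ k, β k * ∫ v, v k ∂(rhoC 0 τ p a b),
          integral_const_mul]
        simp [hM]
    _ ≤ Real.log T + (τ⁻¹ + 2 * α * M) := by linarith

lemma le_nodesIntegral (hτ : 0 < τ) (hp : 1 ≤ p) (ha : ∀ k, 0 < a k) (hb : ∀ k, 0 < b k)
    (hα : 0 < α) :
    ∃ c : ℝ, 0 < c ∧ ∀ T, 1 ≤ T → c * Real.log T ≤ nodesIntegral 0 τ p a b α T := by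
  have := fun k => isProbabilityMeasure_gammaM (ha k) (hb k)
  set A : Set (Fin p → ℝ) := Set.univ.pi fun _ => Set.Icc 1 2 with hA
  have hAm : MeasurableSet A := MeasurableSet.univ_pi fun _ => measurableSet_Icc
  set P := Measure.pi fun k => gammaM (a k) (b k) with hP
  have hq : 0 < P.real A := by
    refine ENNReal.toReal_pos ?_ (measure_ne_top _ _)
    rw [hP, hA, Measure.pi_pi]
    exact Finset.prod_ne_zero_iff.2 fun k _ => (gammaM_Icc_pos (ha k) (hb k)).ne'
  set δ : ℝ := 1 - Real.exp (-(α * psi 0 τ p a b fun _ => 1)) with hδ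
  have hδ0 : 0 < δ := by
    have := mul_pos hα (psi_one_pos hτ hp ha hb)
    simpa [hδ] using this
  refine ⟨δ * P.real A * Real.exp (-τ), by positivity, fun T hT1 => ?_⟩
  have hT : 0 < T := one_pos.trans_le hT1
  have hlog := le_integral_indicator_Ioc_rho0_zero hτ (inv_pos.2 hT) (inv_le_one_of_one_le₀ hT1)
  rw [Real.log_inv, neg_neg] at hlog
  have hind : Integrable (A.indicator fun _ => δ) P := (integrable_const δ).indicator hAm
  have hbox : Integrable ((Set.Ioc T⁻¹ 1).indicator fun _ => (1 : ℝ)) (rho0 0 τ) := by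
    have h := (integrable_indicator_Ioi_rho0_zero hτ (inv_pos.2 hT)).indicator
      (measurableSet_Iic (a := (1 : ℝ)))
    rwa [Set.indicator_indicator, Set.inter_comm, Set.Ioi_inter_Iic] at h
  rw [nodesIntegral_eq_prod]
  calc δ * P.real A * Real.exp (-τ) * Real.log T
      = Real.exp (-τ) * Real.log T * (P.real A * δ) := by ring
    _ ≤ (∫ w, (Set.Ioc T⁻¹ 1).indicator (fun _ => (1 : ℝ)) w ∂(rho0 0 τ)) * (P.real A * δ) :=
        mul_le_mul_of_nonneg_right hlog (by positivity)
    _ = ∫ x, (Set.Ioc T⁻¹ 1).indicator (fun _ => (1 : ℝ)) x.1 * A.indicator (fun _ => δ) x.2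
          ∂((rho0 0 τ).prod P) := by
        rw [integral_prod_mul, integral_indicator_const _ hAm, smul_eq_mul]
    _ ≤ _ := by
        refine integral_mono_ae (hbox.mul_prod hind)
          (integrable_nodesIntegrand hτ ha hb hα hT) ?_
        filter_upwards [ae_prod_pos τ a b] with x hx
        by_cases h : x.1 ∈ Set.Ioc T⁻¹ 1 ∧ x.2 ∈ A
        · rw [Set.indicator_of_mem h.1, Set.indicator_of_mem h.2, one_mul, hδ]
          refine one_sub_exp_neg_mono (mul_le_mul_of_nonneg_left
            (psi_mono hτ ha hb (fun _ => zero_le_one) fun k => ?_) hα.le)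
          have h1 : 1 ≤ T * x.1 := by
            have := mul_le_mul_of_nonneg_left h.1.1.le hT.le
            rwa [mul_inv_cancel₀ hT.ne'] at this
          have h2 : 1 ≤ x.2 k := (h.2 k (Set.mem_univ k)).1
          nlinarith [one_le_mul_of_one_le_of_one_le h1 h2]
        · refine le_of_eq_of_le ?_ (nodesIntegrand_nonneg hα hT hx)
          rcases not_and_or.1 h with h | h <;> simp [h]

end Bounds

/-- For `σ = 0` and fixed `α > 0`, `f(T) = ∫ (1 − e^{−α ψ(2Tw)}) ρ(dw) = Θ(log T)` as
`T → ∞`; consequently `E[V_{α,T}] = α f(T) = Θ(log T)` as `T → ∞`. -/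
theorem nodes_growth_sigma_zero (τ : ℝ) (hτ : 0 < τ) (p : ℕ) (hp : 1 ≤ p)
    (a b : Fin p → ℝ) (ha : ∀ k, 0 < a k) (hb : ∀ k, 0 < b k) (α : ℝ) (hα : 0 < α) :
    (∃ c₁ c₂ T₀ : ℝ, 0 < c₁ ∧ c₁ ≤ c₂ ∧ 1 < T₀ ∧ ∀ T ≥ T₀,
      c₁ * Real.log T ≤ nodesIntegral 0 τ p a b α T ∧
      nodesIntegral 0 τ p a b α T ≤ c₂ * Real.log T) ∧
    (∃ d₁ d₂ T₁ : ℝ, 0 < d₁ ∧ d₁ ≤ d₂ ∧ 1 < T₁ ∧ ∀ T ≥ T₁,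
      d₁ * Real.log T ≤ α * nodesIntegral 0 τ p a b α T ∧
      α * nodesIntegral 0 τ p a b α T ≤ d₂ * Real.log T) := by
  obtain ⟨K, hK, hup⟩ := nodesIntegral_le hτ ha hb hα
  obtain ⟨c, hc, hlow⟩ := le_nodesIntegral hτ hp ha hb hα
  have hmain : ∀ T ≥ Real.exp 1, c * Real.log T ≤ nodesIntegral 0 τ p a b α T ∧
      nodesIntegral 0 τ p a b α T ≤ max c (1 + K) * Real.log T := fun T hT => by
    have hT1 : 1 ≤ T := (Real.one_le_exp zero_le_one).trans hT
    have hlog : 1 ≤ Real.log T := (Real.le_log_iff_exp_le (one_pos.trans_le hT1)).2 hT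
    refine ⟨hlow T hT1, (hup T hT1).trans ?_⟩
    calc Real.log T + K ≤ (1 + K) * Real.log T := by nlinarith
      _ ≤ _ := mul_le_mul_of_nonneg_right (le_max_right _ _) (by linarith)
  have he : 1 < Real.exp 1 := Real.one_lt_exp_iff.2 one_pos
  refine ⟨⟨c, max c (1 + K), Real.exp 1, hc, le_max_left _ _, he, hmain⟩,
    α * c, α * max c (1 + K), Real.exp 1, mul_pos hα hc,
    mul_le_mul_of_nonneg_left (le_max_left _ _) hα.le, he, fun T hT => ?_⟩
  simp only [mul_assoc]
  exact ⟨mul_le_mul_of_nonneg_left (hmain T hT).1 hα.le,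
    mul_le_mul_of_nonneg_left (hmain T hT).2 hα.le⟩
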